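/- Suppose inf_{θ∈[0,2π]} (smallest eigenvalue of F(θ)) > 0, where F(θ) = E e^{−iθ} + D + E† e^{iθ} with D Hermitian. Define Φ(n) := (1/2π)∫₀^{2π} F(θ)⁻¹ e^{−inθ} dθ. Then the matrices H := I − EΦ(1) and K := I − Φ(1)E are invertible. -/

import Mathlib

open Matrix

/-- The symbol `F(θ) = E e^{−iθ} + D + Eᴴ e^{iθ}`. -/
noncomputable def symbolF {d : ℕ} (D E : Matrix (Fin d) (Fin d) ℂ) (θ : ℝ) :
    Matrix (Fin d) (Fin d) ℂ :=
  Complex.exp (-(θ : ℂ) * Complex.I) • E + D + Complex.exp ((θ : ℂ) * Complex.I) • Eᴴ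

/-- The Fourier coefficients `Φ(n) = (1/2π)∫₀^{2π} F(θ)⁻¹ e^{−inθ} dθ`
(defined entrywise). -/
noncomputable def PhiMat {d : ℕ} (D E : Matrix (Fin d) (Fin d) ℂ) (n : ℤ) :
    Matrix (Fin d) (Fin d) ℂ :=
  fun a b => (1 / (2 * (Real.pi : ℂ))) *
    ∫ θ in (0 : ℝ)..(2 * Real.pi),
      Complex.exp (-(n : ℂ) * θ * Complex.I) * ((symbolF D E θ)⁻¹ a b)


noncomputable def ee (k : ℤ) (θ : ℝ) : ℂ := Complex.exp ((k : ℂ) * θ * Complex.I)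

lemma ee_add (k l : ℤ) (θ : ℝ) : ee (k + l) θ = ee k θ * ee l θ := by
  simp only [ee, ← Complex.exp_add]
  congr 1
  push_cast
  ring

lemma ee_star (k : ℤ) (θ : ℝ) : star (ee k θ) = ee (-k) θ := by
  simp only [ee, Complex.star_def, ← Complex.exp_conj]
  simp

lemma ee_cont (k : ℤ) : Continuous (ee k) := by
  unfold ee
  fun_prop

lemma ee_int (k : ℤ) : ∫ θ in (0 : ℝ)..(2 * Real.pi), ee k θ =
    if k = 0 then (2 * Real.pi : ℂ) else 0 := by
  split_ifs with h
  · subst h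
    simp [ee]
  · have hk : (k : ℂ) * Complex.I ≠ 0 := by simp [h]
    have h1 : ∀ θ : ℝ, ee k θ = Complex.exp ((k : ℂ) * Complex.I * θ) := by
      intro θ
      simp only [ee]
      congr 1
      ring
    simp only [h1]
    rw [integral_exp_mul_complex hk]
    have h2 : Complex.exp ((k : ℂ) * Complex.I * ((2 * Real.pi : ℝ) : ℂ)) = 1 := by
      rw [Complex.exp_eq_one_iff]
      exact ⟨k, by push_cast; ring⟩
    rw [h2]
    simp

lemma symbolF_eq {d : ℕ} (D E : Matrix (Fin d) (Fin d) ℂ) (θ : ℝ) :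
    symbolF D E θ = ee (-1) θ • E + D + ee 1 θ • Eᴴ := by
  simp [symbolF, ee]

lemma int_double (N : ℕ) (k : ℕ → ℕ → ℤ) (a : ℕ → ℕ → ℂ) :
    ∫ θ in (0 : ℝ)..(2 * Real.pi), ∑ m ∈ Finset.range N, ∑ n ∈ Finset.range N,
      ee (k m n) θ * a m n
    = 2 * Real.pi * ∑ m ∈ Finset.range N, ∑ n ∈ Finset.range N,
      if k m n = 0 then a m n else 0 := by
  have hc := ee_cont
  rw [intervalIntegral.integral_finsetSum]
  · rw [Finset.mul_sum]
    refine Finset.sum_congr rfl fun m _ => ?_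
    rw [intervalIntegral.integral_finsetSum]
    · rw [Finset.mul_sum]
      refine Finset.sum_congr rfl fun n _ => ?_
      rw [intervalIntegral.integral_mul_const, ee_int]
      split_ifs <;> simp
    · intro n _
      exact Continuous.intervalIntegrable (by fun_prop) _ _
  · intro n _
    exact Continuous.intervalIntegrable (by fun_prop) _ _

lemma cont_double (N : ℕ) (k : ℕ → ℕ → ℤ) (a : ℕ → ℕ → ℂ) :
    Continuous fun θ : ℝ => ∑ m ∈ Finset.range N, ∑ n ∈ Finset.range N,
      ee (k m n) θ * a m n := by
  have hc := ee_cont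
  fun_prop

lemma form_expand {d : ℕ} (M : Matrix (Fin d) (Fin d) ℂ) (c : ℕ → Fin d → ℂ) (N : ℕ) (j : ℤ)
    (θ : ℝ) :
    star (∑ n ∈ Finset.range N, ee n θ • c n) ⬝ᵥ
      ((ee j θ • M) *ᵥ (∑ n ∈ Finset.range N, ee n θ • c n))
    = ∑ m ∈ Finset.range N, ∑ n ∈ Finset.range N,
      ee (n - m + j) θ * (star (c m) ⬝ᵥ (M *ᵥ c n)) := by
  rw [star_sum, sum_dotProduct]
  refine Finset.sum_congr rfl fun m _ => ?_
  rw [mulVec_sum, dotProduct_sum]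
  refine Finset.sum_congr rfl fun n _ => ?_
  rw [star_smul, ee_star, mulVec_smul, smul_mulVec, smul_dotProduct, dotProduct_smul,
    dotProduct_smul, ee_add, sub_eq_add_neg, ee_add]
  simp only [smul_eq_mul]
  ring

lemma ee_zero (θ : ℝ) : ee 0 θ = 1 := by simp [ee]

/-- finite section bound -/
lemma finite_section {d : ℕ}
    (D E : Matrix (Fin d) (Fin d) ℂ) (f : ℝ)
    (hlow : ∀ θ ∈ Set.Icc (0 : ℝ) (2 * Real.pi), ∀ z : Fin d → ℂ,
      f * (star z ⬝ᵥ z).re ≤ (star z ⬝ᵥ (symbolF D E θ).mulVec z).re)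
    (c : ℕ → Fin d → ℂ) (N : ℕ) :
    f * (∑ m ∈ Finset.range N, star (c m) ⬝ᵥ c m).re ≤
      (∑ m ∈ Finset.range N, ∑ n ∈ Finset.range N,
        ((if (n : ℤ) - m + (-1) = 0 then star (c m) ⬝ᵥ (E *ᵥ c n) else 0)
        + (if (n : ℤ) - m + 0 = 0 then star (c m) ⬝ᵥ (D *ᵥ c n) else 0)
        + (if (n : ℤ) - m + 1 = 0 then star (c m) ⬝ᵥ (Eᴴ *ᵥ c n) else 0))).re := by
  let S : Matrix (Fin d) (Fin d) ℂ → ℤ → ℝ → ℂ := fun M j θ =>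
    ∑ m ∈ Finset.range N, ∑ n ∈ Finset.range N,
      ee (n - m + j) θ * (star (c m) ⬝ᵥ (M *ᵥ c n))
  have hS : ∀ M j, Continuous (S M j) := fun M j => cont_double N _ _
  have hI : ∀ M j, ∫ θ in (0 : ℝ)..(2 * Real.pi), S M j θ =
      2 * Real.pi * ∑ m ∈ Finset.range N, ∑ n ∈ Finset.range N,
      if (n : ℤ) - m + j = 0 then star (c m) ⬝ᵥ (M *ᵥ c n) else 0 :=
    fun M j => int_double N (fun m n => (n : ℤ) - m + j) _
  have key : ∀ θ ∈ Set.Icc (0 : ℝ) (2 * Real.pi), f * (S 1 0 θ).re ≤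
      (S E (-1) θ + S D 0 θ + S Eᴴ 1 θ).re := by
    intro θ hθ
    have := hlow θ hθ (∑ n ∈ Finset.range N, ee n θ • c n)
    rw [symbolF_eq, add_mulVec, add_mulVec, dotProduct_add, dotProduct_add, form_expand,
      form_expand] at this
    have h1 := form_expand D c N 0 θ
    have h2 := form_expand (1 : Matrix (Fin d) (Fin d) ℂ) c N 0 θ
    rw [ee_zero, one_smul] at h1 h2
    rw [one_mulVec] at h2
    rw [h1, h2] at this
    exact this
  have hmono := intervalIntegral.integral_mono_on (μ := MeasureTheory.volume) Real.two_pi_pos.le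
    (Continuous.intervalIntegrable (by have := hS 1 0; fun_prop) _ _)
    (Continuous.intervalIntegrable
      (by have := hS E (-1); have := hS D 0; have := hS Eᴴ 1; fun_prop) _ _) key
  have hre : ∀ g : ℝ → ℂ, Continuous g → ∫ θ in (0 : ℝ)..(2 * Real.pi), (g θ).re =
      (∫ θ in (0 : ℝ)..(2 * Real.pi), g θ).re := fun g hg =>
    intervalIntegral.intervalIntegral_re (𝕜 := ℂ) (hg.intervalIntegrable _ _)
  rw [intervalIntegral.integral_const_mul, hre _ (hS 1 0),
    hre (fun θ => S E (-1) θ + S D 0 θ + S Eᴴ 1 θ)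
      (((hS E (-1)).add (hS D 0)).add (hS Eᴴ 1)),
    intervalIntegral.integral_add (f := fun θ => S E (-1) θ + S D 0 θ) ((((hS E (-1)).add (hS D 0))).intervalIntegrable _ _)
      ((hS Eᴴ 1).intervalIntegrable _ _),
    intervalIntegral.integral_add ((hS E (-1)).intervalIntegrable _ _)
      ((hS D 0).intervalIntegrable _ _), hI, hI, hI, hI, ← mul_add, ← mul_add] at hmono
  have hp : ((2 : ℂ) * Real.pi) = ((2 * Real.pi : ℝ) : ℂ) := by push_cast; rfl
  rw [hp, Complex.re_ofReal_mul, Complex.re_ofReal_mul, mul_left_comm] at hmono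
  have h3 := le_of_mul_le_mul_left hmono Real.two_pi_pos
  simp only [Finset.sum_add_distrib]
  refine le_trans (le_of_eq ?_) h3
  congr 2
  refine Finset.sum_congr rfl fun m hm => ?_
  have : ∀ n : ℕ, ((n : ℤ) - m + 0 = 0) ↔ m = n := by intro n; omega
  simp only [this, Finset.sum_ite_eq, hm, if_true, one_mulVec]

lemma re_self {d : ℕ} (z : Fin d → ℂ) :
    (star z ⬝ᵥ z).re = ∑ i, Complex.normSq (z i) := by
  simp [dotProduct, Complex.normSq_apply]

lemma re_self_nonneg {d : ℕ} (z : Fin d → ℂ) : 0 ≤ (star z ⬝ᵥ z).re := by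
  rw [re_self]
  exact Finset.sum_nonneg fun i _ => Complex.normSq_nonneg _

lemma re_self_zero {d : ℕ} (z : Fin d → ℂ) (h : (star z ⬝ᵥ z).re = 0) : z = 0 := by
  rw [re_self, Finset.sum_eq_zero_iff_of_nonneg fun i _ => Complex.normSq_nonneg _] at h
  funext i
  exact Complex.normSq_eq_zero.1 (h i (Finset.mem_univ i))

lemma half_line {d : ℕ}
    (D E : Matrix (Fin d) (Fin d) ℂ) (f : ℝ) (hf : 0 < f)
    (hlow : ∀ θ ∈ Set.Icc (0 : ℝ) (2 * Real.pi), ∀ z : Fin d → ℂ,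
      f * (star z ⬝ᵥ z).re ≤ (star z ⬝ᵥ (symbolF D E θ).mulVec z).re)
    (u : ℕ → Fin d → ℂ) (hu : Filter.Tendsto u Filter.atTop (nhds 0))
    (h0 : E *ᵥ u 1 + D *ᵥ u 0 = 0)
    (h1 : ∀ n, E *ᵥ u (n + 2) + D *ᵥ u (n + 1) + Eᴴ *ᵥ u n = 0) : ∀ n, u n = 0 := by
  have hrow : ∀ N m, m ∈ Finset.range (N + 1) → ∑ n ∈ Finset.range (N + 1),
        ((if (n : ℤ) - m + (-1) = 0 then star (u m) ⬝ᵥ (E *ᵥ u n) else 0)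
        + (if (n : ℤ) - m + 0 = 0 then star (u m) ⬝ᵥ (D *ᵥ u n) else 0)
        + (if (n : ℤ) - m + 1 = 0 then star (u m) ⬝ᵥ (Eᴴ *ᵥ u n) else 0))
      = if N = m then - (star (u m) ⬝ᵥ (E *ᵥ u (m + 1))) else 0 := by
    intro N m hm
    have e1 : ∀ n : ℕ, ((n : ℤ) - m + (-1) = 0) ↔ m + 1 = n := by intro n; omega
    have e2 : ∀ n : ℕ, ((n : ℤ) - m + 0 = 0) ↔ m = n := by intro n; omega
    simp only [Finset.sum_add_distrib, e1, e2, Finset.sum_ite_eq, hm, if_true]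
    have hm' := Finset.mem_range.1 hm
    have hfull : star (u m) ⬝ᵥ (E *ᵥ u (m + 1)) + star (u m) ⬝ᵥ (D *ᵥ u m) +
        ∑ n ∈ Finset.range (N + 1),
          (if (n : ℤ) - m + 1 = 0 then star (u m) ⬝ᵥ (Eᴴ *ᵥ u n) else 0) = 0 := by
      rcases m with _ | k
      · have e3 : ∀ n : ℕ, ¬ ((n : ℤ) - (0 : ℕ) + 1 = 0) := by intro n; omega
        simp only [e3, if_false, Finset.sum_const_zero, add_zero, zero_add]
        rw [← dotProduct_add, h0, dotProduct_zero]
      · have e3 : ∀ n : ℕ, ((n : ℤ) - (k + 1 : ℕ) + 1 = 0) ↔ k = n := by intro n; omega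
        have hk : k ∈ Finset.range (N + 1) := by simp; omega
        simp only [e3, Finset.sum_ite_eq, hk, if_true]
        rw [← dotProduct_add, ← dotProduct_add, h1, dotProduct_zero]
    by_cases hN : N = m
    · subst hN
      simp only [Finset.mem_range, lt_irrefl, if_false, if_true]
      linear_combination hfull
    · have : m + 1 ∈ Finset.range (N + 1) := by simp; omega
      simp only [this, if_true, hN, if_false]
      exact hfull
  have hb : ∀ N, f * (∑ m ∈ Finset.range (N + 1), star (u m) ⬝ᵥ u m).re ≤
      (- (star (u N) ⬝ᵥ (E *ᵥ u (N + 1)))).re := by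
    intro N
    have := finite_section D E f hlow u (N + 1)
    rw [Finset.sum_congr rfl (hrow N)] at this
    simpa using this
  have hlim : Filter.Tendsto (fun N => (- (star (u N) ⬝ᵥ (E *ᵥ u (N + 1)))).re)
      Filter.atTop (nhds 0) := by
    have hcont : Continuous fun p : (Fin d → ℂ) × (Fin d → ℂ) =>
        (- (star p.1 ⬝ᵥ (E *ᵥ p.2))).re := by fun_prop
    have h := (hcont.tendsto (0, 0)).comp (hu.prodMk_nhds (hu.comp (Filter.tendsto_add_atTop_nat 1)))
    simpa [Function.comp_def] using h
  have hnn : ∀ z : Fin d → ℂ, 0 ≤ (star z ⬝ᵥ z).re := re_self_nonneg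
  intro n
  have hle : f * (star (u n) ⬝ᵥ u n).re ≤ 0 := by
    refine ge_of_tendsto hlim ?_
    filter_upwards [Filter.eventually_ge_atTop n] with N hN
    refine le_trans ?_ (hb N)
    rw [Complex.re_sum]
    exact mul_le_mul_of_nonneg_left
      (Finset.single_le_sum (f := fun m => (star (u m) ⬝ᵥ u m).re) (fun m _ => hnn _)
        (Finset.mem_range.2 (by omega))) hf.le
  have hz : (star (u n) ⬝ᵥ u n).re = 0 := le_antisymm (by nlinarith) (hnn _)
  exact re_self_zero _ hz

lemma symbolF_det {d : ℕ}
    (D E : Matrix (Fin d) (Fin d) ℂ) (f : ℝ) (hf : 0 < f)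
    (hlow : ∀ θ ∈ Set.Icc (0 : ℝ) (2 * Real.pi), ∀ z : Fin d → ℂ,
      f * (star z ⬝ᵥ z).re ≤ (star z ⬝ᵥ (symbolF D E θ).mulVec z).re)
    (θ : ℝ) (hθ : θ ∈ Set.Icc (0 : ℝ) (2 * Real.pi)) : (symbolF D E θ).det ≠ 0 := by
  intro h
  obtain ⟨v, hv, hv0⟩ := Matrix.exists_mulVec_eq_zero_iff.2 h
  have h1 := hlow θ hθ v
  rw [hv0, dotProduct_zero, Complex.zero_re] at h1
  have h3 := re_self_nonneg v
  exact hv (re_self_zero v (le_antisymm (by nlinarith) h3))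

lemma symbolF_cont {d : ℕ} (D E : Matrix (Fin d) (Fin d) ℂ) : Continuous (symbolF D E) := by
  unfold symbolF
  fun_prop

lemma inv_cont {d : ℕ} (D E : Matrix (Fin d) (Fin d) ℂ)
    (hdet : ∀ θ ∈ Set.Icc (0 : ℝ) (2 * Real.pi), (symbolF D E θ).det ≠ 0) (a b : Fin d) :
    ContinuousOn (fun θ => (symbolF D E θ)⁻¹ a b) (Set.Icc (0 : ℝ) (2 * Real.pi)) := by
  have h1 := (symbolF_cont D E).matrix_det
  have h2 := ((symbolF_cont D E).matrix_adjugate).matrix_elem a b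
  have : (fun θ => (symbolF D E θ)⁻¹ a b) =
      fun θ => ((symbolF D E θ).det)⁻¹ * (symbolF D E θ).adjugate a b := by
    funext θ
    rw [Matrix.inv_def, Matrix.smul_apply, Ring.inverse_eq_inv', smul_eq_mul]
  rw [this]
  exact (h1.continuousOn.inv₀ hdet).mul h2.continuousOn

lemma Phi_apply {d : ℕ} (D E : Matrix (Fin d) (Fin d) ℂ) (n : ℤ) (a b : Fin d) :
    PhiMat D E n a b = (1 / (2 * (Real.pi : ℂ))) *
      ∫ θ in (0 : ℝ)..(2 * Real.pi), ee (-n) θ * ((symbolF D E θ)⁻¹ a b) := by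
  simp [PhiMat, ee]

lemma mul_Phi {d : ℕ} (D E : Matrix (Fin d) (Fin d) ℂ)
    (hdet : ∀ θ ∈ Set.Icc (0 : ℝ) (2 * Real.pi), (symbolF D E θ).det ≠ 0)
    (M : Matrix (Fin d) (Fin d) ℂ) (n : ℤ) (a b : Fin d) :
    (M * PhiMat D E n) a b = (1 / (2 * (Real.pi : ℂ))) *
      ∫ θ in (0 : ℝ)..(2 * Real.pi), ee (-n) θ * ((M * (symbolF D E θ)⁻¹) a b) := by
  simp only [Matrix.mul_apply, Phi_apply, Finset.mul_sum]
  rw [intervalIntegral.integral_finsetSum, Finset.mul_sum]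
  · refine Finset.sum_congr rfl fun j _ => ?_
    have : ∀ θ, ee (-n) θ * (M a j * (symbolF D E θ)⁻¹ j b) =
      M a j * (ee (-n) θ * (symbolF D E θ)⁻¹ j b) := fun θ => by ring
    simp only [this]
    rw [intervalIntegral.integral_const_mul]
    ring
  · intro j _
    apply ContinuousOn.intervalIntegrable
    rw [Set.uIcc_of_le Real.two_pi_pos.le]
    exact (ee_cont _).continuousOn.mul (continuousOn_const.mul (inv_cont D E hdet j b))

lemma mul_int {d : ℕ} (D E : Matrix (Fin d) (Fin d) ℂ)
    (hdet : ∀ θ ∈ Set.Icc (0 : ℝ) (2 * Real.pi), (symbolF D E θ).det ≠ 0)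
    (M : Matrix (Fin d) (Fin d) ℂ) (n : ℤ) (a b : Fin d) :
    IntervalIntegrable (fun θ => ee n θ * ((M * (symbolF D E θ)⁻¹) a b))
      MeasureTheory.volume 0 (2 * Real.pi) := by
  apply ContinuousOn.intervalIntegrable
  rw [Set.uIcc_of_le Real.two_pi_pos.le]
  simp only [Matrix.mul_apply]
  exact (ee_cont _).continuousOn.mul
    (continuousOn_finsetSum _ fun j _ => continuousOn_const.mul (inv_cont D E hdet j b))

lemma Phi_rec {d : ℕ} (D E : Matrix (Fin d) (Fin d) ℂ)
    (hdet : ∀ θ ∈ Set.Icc (0 : ℝ) (2 * Real.pi), (symbolF D E θ).det ≠ 0) (n : ℤ) :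
    E * PhiMat D E (n + 1) + D * PhiMat D E n + Eᴴ * PhiMat D E (n - 1) =
      if n = 0 then 1 else 0 := by
  ext a b
  rw [Matrix.add_apply, Matrix.add_apply, mul_Phi D E hdet, mul_Phi D E hdet, mul_Phi D E hdet,
    ← mul_add, ← mul_add, ← intervalIntegral.integral_add (mul_int D E hdet _ _ _ _)
      (mul_int D E hdet _ _ _ _), ← intervalIntegral.integral_add
      ((mul_int D E hdet _ _ _ _).add (mul_int D E hdet _ _ _ _)) (mul_int D E hdet _ _ _ _)]
  have hcg : ∫ θ in (0 : ℝ)..(2 * Real.pi),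
      (ee (-(n + 1)) θ * ((E * (symbolF D E θ)⁻¹) a b) + ee (-n) θ * ((D * (symbolF D E θ)⁻¹) a b)
        + ee (-(n - 1)) θ * ((Eᴴ * (symbolF D E θ)⁻¹) a b)) =
      ∫ θ in (0 : ℝ)..(2 * Real.pi), ee (-n) θ * (1 : Matrix (Fin d) (Fin d) ℂ) a b := by
    apply intervalIntegral.integral_congr
    intro θ hθ
    rw [Set.uIcc_of_le Real.two_pi_pos.le] at hθ
    have hone : (1 : Matrix (Fin d) (Fin d) ℂ) = symbolF D E θ * (symbolF D E θ)⁻¹ :=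
      (Matrix.mul_nonsing_inv _ (isUnit_iff_ne_zero.2 (hdet θ hθ))).symm
    have e1 : ee (-(n + 1)) θ = ee (-n) θ * ee (-1) θ := by rw [← ee_add]; congr 1; ring
    have e2 : ee (-(n - 1)) θ = ee (-n) θ * ee 1 θ := by rw [← ee_add]; congr 1; ring
    have hF : (symbolF D E θ * (symbolF D E θ)⁻¹) =
        ee (-1) θ • (E * (symbolF D E θ)⁻¹) + D * (symbolF D E θ)⁻¹ +
        ee 1 θ • (Eᴴ * (symbolF D E θ)⁻¹) := by
      conv_lhs => rw [show symbolF D E θ * (symbolF D E θ)⁻¹ =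
        (ee (-1) θ • E + D + ee 1 θ • Eᴴ) * (symbolF D E θ)⁻¹ by rw [← symbolF_eq]]
      rw [Matrix.add_mul, Matrix.add_mul, Matrix.smul_mul, Matrix.smul_mul]
    simp only
    rw [hone, hF, e1, e2]
    simp only [Matrix.add_apply, Matrix.smul_apply, smul_eq_mul]
    ring
  rw [hcg, intervalIntegral.integral_mul_const, ee_int]
  have hpi : (2 * (Real.pi : ℂ)) ≠ 0 := by simp [Real.pi_ne_zero]
  by_cases hn : n = 0
  · simp [hn]
    field_simp
  · simp [hn]

lemma Phi_tendsto {d : ℕ} (D E : Matrix (Fin d) (Fin d) ℂ) (a b : Fin d) :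
    Filter.Tendsto (fun n : ℤ => PhiMat D E n a b) Filter.cofinite (nhds 0) := by
  have h := (Real.tendsto_integral_exp_smul_cocompact
    ((Set.Ioc 0 (2 * Real.pi)).indicator fun θ => (symbolF D E θ)⁻¹ a b))
  have hsc : Filter.Tendsto (fun n : ℤ => (n : ℝ) * (2 * Real.pi)⁻¹) Filter.cofinite
      (Filter.cocompact ℝ) :=
    ((Homeomorph.mulRight₀ ((2 * Real.pi)⁻¹) (by positivity)).isClosedEmbedding.tendsto_cocompact).comp
      Int.tendsto_coe_cofinite
  have h2 := ((h.comp hsc).const_mul (1 / (2 * (Real.pi : ℂ))))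
  rw [mul_zero] at h2
  refine h2.congr fun n => ?_
  rw [Phi_apply, intervalIntegral.integral_of_le Real.two_pi_pos.le,
    ← MeasureTheory.integral_indicator measurableSet_Ioc]
  simp only [Function.comp]
  congr 2
  funext θ
  by_cases hθ : θ ∈ Set.Ioc 0 (2 * Real.pi)
  · rw [Set.indicator_of_mem hθ, Set.indicator_of_mem hθ, Circle.smul_def, smul_eq_mul,
      Real.fourierChar_apply, ee]
    congr 3
    have : (Real.pi : ℂ) ≠ 0 := by simp [Real.pi_ne_zero]
    push_cast
    field_simp
  · rw [Set.indicator_of_notMem hθ, Set.indicator_of_notMem hθ, smul_zero]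

lemma vec_tendsto {d : ℕ} (D E : Matrix (Fin d) (Fin d) ℂ) (v : Fin d → ℂ) (g : ℕ → ℤ)
    (hg : Function.Injective g) :
    Filter.Tendsto (fun n => PhiMat D E (g n) *ᵥ v) Filter.atTop (nhds 0) := by
  rw [tendsto_pi_nhds]
  intro a
  simp only [mulVec, dotProduct, Pi.zero_apply]
  have : (0 : ℂ) = ∑ b : Fin d, 0 * v b := by simp
  rw [this]
  refine tendsto_finsetSum _ fun b _ => Filter.Tendsto.mul_const _ ?_
  rw [← Nat.cofinite_eq_atTop]
  exact (Phi_tendsto D E a b).comp hg.tendsto_cofinite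

/-- if the smallest eigenvalue of `F(θ)` is uniformly bounded
below by a positive constant on `[0,2π]`, then `H = I − EΦ(1)` and
`K = I − Φ(1)E` are invertible. -/
theorem H_and_K_invertible {d : ℕ}
    (D E : Matrix (Fin d) (Fin d) ℂ) (hD : D.IsHermitian)
    (f : ℝ) (hf : 0 < f)
    (hlow : ∀ θ ∈ Set.Icc (0 : ℝ) (2 * Real.pi), ∀ z : Fin d → ℂ,
      f * (star z ⬝ᵥ z).re ≤ (star z ⬝ᵥ (symbolF D E θ).mulVec z).re) :
    IsUnit (1 - E * PhiMat D E 1) ∧ IsUnit (1 - PhiMat D E 1 * E) := by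
  have hdet := symbolF_det D E f hf hlow
  have hH : IsUnit (1 - E * PhiMat D E 1).det := by
    rw [isUnit_iff_ne_zero]
    intro h
    obtain ⟨v, hv, hv0⟩ := Matrix.exists_mulVec_eq_zero_iff.2 h
    apply hv
    have hrec : ∀ n : ℤ, E *ᵥ (PhiMat D E (n + 1) *ᵥ v) + D *ᵥ (PhiMat D E n *ᵥ v)
        + Eᴴ *ᵥ (PhiMat D E (n - 1) *ᵥ v) = if n = 0 then v else 0 := by
      intro n
      simp only [mulVec_mulVec, ← add_mulVec, Phi_rec D E hdet]
      split_ifs <;> simp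
    have hE : E *ᵥ (PhiMat D E 1 *ᵥ v) = v := by
      rw [sub_mulVec, one_mulVec, ← mulVec_mulVec, sub_eq_zero] at hv0
      exact hv0.symm
    have hlow' : ∀ θ ∈ Set.Icc (0 : ℝ) (2 * Real.pi), ∀ z : Fin d → ℂ,
        f * (star z ⬝ᵥ z).re ≤ (star z ⬝ᵥ (symbolF D Eᴴ θ).mulVec z).re := by
      intro θ hθ z
      have h1 := hlow (2 * Real.pi - θ) ⟨by linarith [hθ.2], by linarith [hθ.1]⟩ z
      have h2 : symbolF D E (2 * Real.pi - θ) = symbolF D Eᴴ θ := by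
        have e1 : Complex.exp (-((2 * Real.pi - θ : ℝ) : ℂ) * Complex.I) =
            Complex.exp ((θ : ℂ) * Complex.I) := by
          rw [Complex.exp_eq_exp_iff_exists_int]
          exact ⟨-1, by push_cast; ring⟩
        have e2 : Complex.exp (((2 * Real.pi - θ : ℝ) : ℂ) * Complex.I) =
            Complex.exp (-(θ : ℂ) * Complex.I) := by
          rw [Complex.exp_eq_exp_iff_exists_int]
          exact ⟨1, by push_cast; ring⟩
        rw [symbolF, symbolF, e1, e2, conjTranspose_conjTranspose]
        abel
      rwa [h2] at h1
    have hneg := half_line D Eᴴ f hf hlow' (fun n => PhiMat D E (-(n : ℤ)) *ᵥ v)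
      (vec_tendsto D E v _ fun a b hab => by simpa using hab)
      (by
        have := hrec 0
        rw [zero_add, hE, if_pos rfl, add_assoc, add_eq_left] at this
        rw [add_comm]
        simpa using this)
      (by
        intro n
        have := hrec (-((n + 1 : ℕ) : ℤ))
        rw [if_neg (by omega), show -((n + 1 : ℕ) : ℤ) + 1 = -(n : ℤ) by omega,
          show -((n + 1 : ℕ) : ℤ) - 1 = -((n + 2 : ℕ) : ℤ) by omega] at this
        rw [conjTranspose_conjTranspose, ← this]
        abel)
    have hu0 : PhiMat D E 0 *ᵥ v = 0 := by simpa using hneg 0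
    have hpos := half_line D E f hf hlow (fun n => PhiMat D E ((n : ℤ) + 1) *ᵥ v)
      (vec_tendsto D E v _ fun a b hab => by simpa using hab)
      (by
        have := hrec 1
        rw [if_neg (by omega), sub_self, hu0, mulVec_zero, add_zero] at this
        simpa using this)
      (by
        intro n
        have := hrec ((n : ℤ) + 2)
        rw [if_neg (by omega), show (n : ℤ) + 2 - 1 = n + 1 by omega] at this
        rw [← this]
        push_cast
        rw [show (n : ℤ) + 1 + 1 = n + 2 by omega])
    have hu1 : PhiMat D E 1 *ᵥ v = 0 := by simpa using hpos 0
    rw [← hE, hu1, mulVec_zero]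
  refine ⟨(Matrix.isUnit_iff_isUnit_det _).2 hH, (Matrix.isUnit_iff_isUnit_det _).2 ?_⟩
  rwa [Matrix.det_one_sub_mul_comm]
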